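/- arXiv:2510.13174 — 11 statements merged into one kernel-verified Lean document; each statement's English description precedes it below -/
import Mathlib

section
/- Let Λ be a nonempty set, S a nonempty set, n ≥ 1, L : Sⁿ × Λ → ℝ a function, and T : Sⁿ → 𝒯 a surjective map onto a set 𝒯. Then the following are equivalent: (i) for all r, s ∈ Sⁿ with T(r) = T(s), the map λ ↦ L(r; λ) − L(s; λ) is constant on Λ; (ii) there exist functions p : Λ × 𝒯 → ℝ and q : Sⁿ → ℝ such that L(y; λ) = p(λ, T(y)) + q(y) for all y ∈ Sⁿ and all λ ∈ Λ. -/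
/-- **Generalized factorization theorem** (Gayen–Kumar).
`T` is a generalized sufficient statistic for the generalized likelihood function `L`
(i.e. `λ ↦ L r λ - L s λ` is constant whenever `T r = T s`) if and only if
`L` factorizes as `L y λ = p λ (T y) + q y`. -/
theorem generalized_factorization_theorem
    {Λ S 𝒯 : Type*} [Nonempty Λ] [Nonempty S]
    (n : ℕ) (hn : 1 ≤ n)
    (L : (Fin n → S) → Λ → ℝ)
    (T : (Fin n → S) → 𝒯) (hT : Function.Surjective T) :
    (∀ r s : Fin n → S, T r = T s →
        ∀ l₁ l₂ : Λ, L r l₁ - L s l₁ = L r l₂ - L s l₂) ↔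
      (∃ (p : Λ → 𝒯 → ℝ) (q : (Fin n → S) → ℝ),
        ∀ (y : Fin n → S) (l : Λ), L y l = p l (T y) + q y) := by
  constructor
  · intro h
    obtain ⟨l₀⟩ := ‹Nonempty Λ›
    obtain ⟨g, hg⟩ := hT.hasRightInverse
    refine ⟨fun l t => L (g t) l, fun y => L y l₀ - L (g (T y)) l₀, fun y l => ?_⟩
    linarith [h y (g (T y)) (hg (T y)).symm l l₀]
  · rintro ⟨p, q, h⟩ r s hrs l₁ l₂
    simp only [h, hrs]
    ring
end

section
/- Let T : Ω → 𝒯 be a generalized sufficient statistic, let δ : Ω → ℝ be measurable with Ẽ_λ[|δ|] < ∞ for every λ ∈ Λ, and let g : 𝒯 → ℝ be measurable such that g ∘ T is a version of the conditional expectation of δ given the σ-algebra generated by T under P̃_λ for every λ ∈ Λ. Let L₀ : Λ × ℝ → [0, ∞) be a loss function such that for each λ the map d ↦ L₀(λ, d) is strictly convex. Then for every λ ∈ Λ with Ẽ_λ[L₀(λ, δ)] < ∞ one has Ẽ_λ[L₀(λ, g(T))] ≤ Ẽ_λ[L₀(λ, δ)], and the inequality is strict unless P̃_λ(δ = g(T))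 = 1. -/
open MeasureTheory

/-- A statistic `T` is *generalized sufficient* for the family of deformed probability
measures `P` if, for every statistic `φ` integrable under every `P λ`, there is a single
measurable `g` such that `g ∘ T` is a version of the conditional expectation of `φ`
given the σ-algebra generated by `T`, simultaneously for every `λ`. -/
def GenSufficient {Ω Λ 𝒯 : Type*} [MeasurableSpace Ω] [MeasurableSpace 𝒯]
    (P : Λ → Measure Ω) (T : Ω → 𝒯) : Prop :=
  ∀ φ : Ω → ℝ, Measurable φ → (∀ l, Integrable φ (P l)) →
    ∃ g : 𝒯 → ℝ, Measurable g ∧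
      ∀ l, (fun ω => g (T ω)) =ᵐ[P l] (P l)[φ | MeasurableSpace.comap T inferInstance]

/-- A statistic `T` is *generalized complete* for the family of deformed probability
measures `P` if every measurable `h` with `h ∘ T` integrable and of mean zero under every
`P λ` vanishes `P λ`-almost surely for every `λ`. -/
def GenComplete {Ω Λ 𝒯 : Type*} [MeasurableSpace Ω] [MeasurableSpace 𝒯]
    (P : Λ → Measure Ω) (T : Ω → 𝒯) : Prop :=
  ∀ h : 𝒯 → ℝ, Measurable h → (∀ l, Integrable (fun ω => h (T ω)) (P l)) →
    (∀ l, ∫ ω, h (T ω) ∂(P l) = 0) →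
    ∀ l, P l {ω | h (T ω) = 0} = 1

section ConditionalJensen

variable {Ω : Type*} {m mΩ : MeasurableSpace Ω} {μ : Measure Ω} [IsFiniteMeasure μ]
  {φ : ℝ → ℝ} {X Y : Ω → ℝ}

/-- If `φ ≥ 0` is convex and `Y` is a version of `μ[X | m]`, then integrability of `φ ∘ X`
passes to `φ ∘ Y`. -/
lemma ConvexOn.integrable_comp_condExp (hm : m ≤ mΩ) (hφ : ConvexOn ℝ Set.univ φ)
    (hφ0 : ∀ x, 0 ≤ φ x) (hX : Integrable X μ) (hφX : Integrable (fun ω => φ (X ω)) μ)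
    (hY : Y =ᵐ[μ] μ[X | m]) :
    Integrable (fun ω => φ (Y ω)) μ := by
  have hcont : Continuous φ := continuousOn_univ.1 (hφ.continuousOn isOpen_univ)
  have hYm : AEStronglyMeasurable Y μ := (integrable_condExp.congr hY.symm).aestronglyMeasurable
  refine (integrable_condExp (m := m) (f := φ ∘ X) (μ := μ)).mono'
    (hcont.comp_aestronglyMeasurable hYm) ?_
  filter_upwards [hφ.map_condExp_le_of_finiteDimensional hm hX hφX, hY] with ω h hω
  rw [Real.norm_of_nonneg (hφ0 _), hω]
  exact h

/-- If `φ ≥ 0` is convex and `Y` is a version of `μ[X | m]`, then `∫ φ ∘ Y ≤ ∫ φ ∘ X`. -/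
lemma ConvexOn.integral_comp_condExp_le (hm : m ≤ mΩ) (hφ : ConvexOn ℝ Set.univ φ)
    (hφ0 : ∀ x, 0 ≤ φ x) (hX : Integrable X μ) (hφX : Integrable (fun ω => φ (X ω)) μ)
    (hY : Y =ᵐ[μ] μ[X | m]) :
    ∫ ω, φ (Y ω) ∂μ ≤ ∫ ω, φ (X ω) ∂μ := by
  rw [← integral_condExp hm (f := fun ω => φ (X ω))]
  refine integral_mono_ae (hφ.integrable_comp_condExp hm hφ0 hX hφX hY) integrable_condExp ?_
  filter_upwards [hφ.map_condExp_le_of_finiteDimensional hm hX hφX, hY] with ω h hω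
  rw [hω]
  exact h

/-- If `φ ≥ 0` is strictly convex and `Y` is a version of `μ[X | m]` which does not agree with `X`
almost everywhere, then `∫ φ ∘ Y < ∫ φ ∘ X`. -/
lemma StrictConvexOn.integral_comp_condExp_lt (hm : m ≤ mΩ) (hφ : StrictConvexOn ℝ Set.univ φ)
    (hφ0 : ∀ x, 0 ≤ φ x) (hX : Integrable X μ) (hφX : Integrable (fun ω => φ (X ω)) μ)
    (hY : Y =ᵐ[μ] μ[X | m]) (hne : ¬ X =ᵐ[μ] Y) :
    ∫ ω, φ (Y ω) ∂μ < ∫ ω, φ (X ω) ∂μ := by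
  have hcont : Continuous φ := continuousOn_univ.1 (hφ.convexOn.continuousOn isOpen_univ)
  have hYi : Integrable Y μ := integrable_condExp.congr hY.symm
  have hφY := hφ.convexOn.integrable_comp_condExp hm hφ0 hX hφX hY
  set Z : Ω → ℝ := (2⁻¹ : ℝ) • (X + Y) with hZ
  have hZi : Integrable Z μ := (hX.add hYi).smul _
  have hYZ : Y =ᵐ[μ] μ[Z | m] := by
    filter_upwards [condExp_smul (μ := μ) (2⁻¹ : ℝ) (X + Y) m, condExp_add hX hYi m,
      condExp_congr_ae (m := m) hY, condExp_condExp_of_le (μ := μ) (f := X) le_rfl hm, hY]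
      with ω h1 h2 h3 h4 h5
    rw [hZ, h1, Pi.smul_apply, h2, Pi.add_apply, h3, h4, h5, smul_eq_mul]
    ring
  have hmid_lt : ∀ ω, X ω ≠ Y ω → φ (Z ω) < 2⁻¹ * (φ (X ω) + φ (Y ω)) := fun ω h => by
    have := hφ.2 (Set.mem_univ (X ω)) (Set.mem_univ (Y ω)) h
      (by norm_num : (0 : ℝ) < 2⁻¹) (by norm_num : (0 : ℝ) < 2⁻¹) (by norm_num)
    simpa [hZ, mul_add] using this
  have hmid_le : ∀ ω, φ (Z ω) ≤ 2⁻¹ * (φ (X ω) + φ (Y ω)) := fun ω => by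
    by_cases h : X ω = Y ω
    · have : Z ω = Y ω := by simp only [hZ, Pi.smul_apply, Pi.add_apply, smul_eq_mul, h]; ring
      rw [this, h]
      exact le_of_eq (by ring)
    · exact (hmid_lt ω h).le
  have hmid : Integrable (fun ω => 2⁻¹ * (φ (X ω) + φ (Y ω))) μ := (hφX.add hφY).const_mul _
  have hφZ : Integrable (fun ω => φ (Z ω)) μ :=
    hmid.mono' (hcont.comp_aestronglyMeasurable hZi.aestronglyMeasurable)
      (.of_forall fun ω => by rw [Real.norm_of_nonneg (hφ0 _)]; exact hmid_le ω)
  have hle : ∫ ω, φ (Y ω) ∂μ ≤ ∫ ω, φ (Z ω) ∂μ :=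
    hφ.convexOn.integral_comp_condExp_le hm hφ0 hZi hφZ hYZ
  have hlt : ∫ ω, φ (Z ω) ∂μ < ∫ ω, 2⁻¹ * (φ (X ω) + φ (Y ω)) ∂μ := by
    refine (integral_mono hφZ hmid hmid_le).lt_of_ne fun heq => hne ?_
    filter_upwards [(integral_eq_iff_of_ae_le hφZ hmid (.of_forall hmid_le)).1 heq] with ω hω
    by_contra h
    exact (hmid_lt ω h).ne hω
  rw [integral_const_mul, integral_add hφX hφY] at hlt
  linarith

end ConditionalJensen

/-- Normalising the density `exp ∘ f` by its integral gives a probability measure. -/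
lemma isProbabilityMeasure_withDensity_exp_div {Ω : Type*} [MeasurableSpace Ω] {ν : Measure Ω}
    {f : Ω → ℝ} (hint : Integrable (fun ω => Real.exp (f ω)) ν)
    (hpos : 0 < ∫ ω, Real.exp (f ω) ∂ν) :
    IsProbabilityMeasure (ν.withDensity fun ω =>
      ENNReal.ofReal (Real.exp (f ω) / ∫ ω', Real.exp (f ω') ∂ν)) := by
  constructor
  rw [withDensity_apply _ MeasurableSet.univ, setLIntegral_univ,
    ← ofReal_integral_eq_lintegral_ofReal (hint.div_const _)
    (.of_forall fun ω => div_nonneg (Real.exp_pos _).le hpos.le), integral_div,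
    div_self hpos.ne', ENNReal.ofReal_one]

/-- **Generalized Rao–Blackwell theorem**: conditioning an estimator on a generalized
sufficient statistic does not increase the generalized risk for a strictly convex loss,
and strictly decreases it unless the estimator is already a function of `T` a.s. -/
theorem generalized_rao_blackwell
    {Ω Λ 𝒯 : Type*} [MeasurableSpace Ω] [MeasurableSpace 𝒯] [Nonempty Λ]
    (ν : Measure Ω) [SigmaFinite ν]
    (L : Ω → Λ → ℝ) (hLmeas : ∀ l, Measurable fun ω => L ω l)
    (hLint : ∀ l, Integrable (fun ω => Real.exp (L ω l)) ν)
    (hLpos : ∀ l, 0 < ∫ ω, Real.exp (L ω l) ∂ν)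
    (P : Λ → Measure Ω)
    (hP : ∀ l, P l = ν.withDensity fun ω =>
      ENNReal.ofReal (Real.exp (L ω l) / ∫ ω', Real.exp (L ω' l) ∂ν))
    (T : Ω → 𝒯) (hT : Measurable T)
    (hsuff : GenSufficient P T)
    (δ : Ω → ℝ) (hδ : Measurable δ) (hδint : ∀ l, Integrable δ (P l))
    (g : 𝒯 → ℝ) (hg : Measurable g)
    (hgce : ∀ l, (fun ω => g (T ω)) =ᵐ[P l] (P l)[δ | MeasurableSpace.comap T inferInstance])
    (L₀ : Λ → ℝ → ℝ) (hL₀nonneg : ∀ l x, 0 ≤ L₀ l x)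
    (hL₀conv : ∀ l, StrictConvexOn ℝ Set.univ (L₀ l)) :
    ∀ l, Integrable (fun ω => L₀ l (δ ω)) (P l) →
      (∫ ω, L₀ l (g (T ω)) ∂(P l) ≤ ∫ ω, L₀ l (δ ω) ∂(P l)) ∧
      (P l {ω | δ ω = g (T ω)} ≠ 1 →
        ∫ ω, L₀ l (g (T ω)) ∂(P l) < ∫ ω, L₀ l (δ ω) ∂(P l)) := by
  intro l hint
  have : IsProbabilityMeasure (P l) :=
    hP l ▸ isProbabilityMeasure_withDensity_exp_div (hLint l) (hLpos l)
  refine ⟨(hL₀conv l).convexOn.integral_comp_condExp_le hT.comap_le (hL₀nonneg l) (hδint l) hint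
    (hgce l), fun hne => (hL₀conv l).integral_comp_condExp_lt hT.comap_le (hL₀nonneg l) (hδint l)
    hint (hgce l) fun h => hne ?_⟩
  exact (mem_ae_iff_prob_eq_one (measurableSet_eq_fun hδ (hg.comp hT))).1 h
end

section
/- Let T : Ω → 𝒯 be both generalized sufficient and generalized complete, and let A : Ω → ℝ be a generalized ancillary statistic, i.e., a measurable map such that for every a ∈ ℝ the map λ ↦ P̃_λ(A ≤ a) is constant on Λ. Then for every λ ∈ Λ, A and T are independent under P̃_λ: P̃_λ({A ≤ a} ∩ T⁻¹(B)) = P̃_λ(A ≤ a) · P̃_λ(T⁻¹(B)) for all a ∈ ℝ and all measurable B ⊆ 𝒯. -/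
open MeasureTheory

/-- Normalizing a density of positive finite mass gives a probability measure. -/
theorem isProbabilityMeasure_of_eq_withDensity_div {Ω : Type*} [MeasurableSpace Ω]
    {ν P : Measure Ω} {f : Ω → ℝ} (hf : Integrable (fun ω => Real.exp (f ω)) ν)
    (hpos : 0 < ∫ ω, Real.exp (f ω) ∂ν)
    (hP : P = ν.withDensity fun ω =>
      ENNReal.ofReal (Real.exp (f ω) / ∫ ω', Real.exp (f ω') ∂ν)) :
    IsProbabilityMeasure P := by
  refine ⟨?_⟩
  rw [hP, withDensity_apply _ MeasurableSet.univ, Measure.restrict_univ,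
    ← ofReal_integral_eq_lintegral_ofReal (hf.div_const _)
      (Filter.Eventually.of_forall fun ω => by positivity),
    integral_div, div_self hpos.ne', ENNReal.ofReal_one]

/-- An event whose probability does not depend on the parameter is independent of every
complete sufficient statistic. -/
theorem GenComplete.measure_inter_preimage_eq_mul {Ω Λ 𝒯 : Type*} [MeasurableSpace Ω]
    [MeasurableSpace 𝒯] {P : Λ → Measure Ω} [∀ l, IsProbabilityMeasure (P l)] {T : Ω → 𝒯}
    (hcomp : GenComplete P T) (hsuff : GenSufficient P T) (hT : Measurable T)
    {S : Set Ω} (hS : MeasurableSet S) (hanc : ∀ l₁ l₂, P l₁ S = P l₂ S)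
    (l : Λ) {B : Set 𝒯} (hB : MeasurableSet B) :
    P l (S ∩ T ⁻¹' B) = P l S * P l (T ⁻¹' B) := by
  have hle := hT.comap_le
  have hint : ∀ k, Integrable (S.indicator fun _ => (1 : ℝ)) (P k) := fun k =>
    (integrable_const 1).indicator hS
  obtain ⟨g, hg, hgT⟩ := hsuff _ (measurable_const.indicator hS) hint
  have hgint : ∀ k, Integrable (fun ω => g (T ω)) (P k) := fun k =>
    integrable_condExp.congr (hgT k).symm
  have hzero := hcomp (fun t => g t - (P l).real S) (hg.sub_const _)
    (fun k => (hgint k).sub (integrable_const _)) (fun k => by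
      rw [integral_sub (hgint k) (integrable_const _), integral_congr_ae (hgT k),
        integral_condExp hle, integral_indicator_const _ hS]
      simp [Measure.real, hanc k l]) l
  have hconst : ∀ᵐ ω ∂(P l), g (T ω) = (P l).real S := by
    have hmeas : MeasurableSet {ω | g (T ω) - (P l).real S = 0} :=
      ((hg.comp hT).sub_const _) (measurableSet_singleton 0)
    filter_upwards [(prob_compl_eq_zero_iff hmeas).2 hzero] with ω hω
    exact sub_eq_zero.1 hω
  have hset : ∫ ω in T ⁻¹' B, S.indicator (fun _ => (1 : ℝ)) ω ∂(P l)
      = (P l).real S * (P l).real (T ⁻¹' B) := by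
    rw [← setIntegral_condExp hle (hint l) ⟨B, hB, rfl⟩,
      integral_congr_ae (ae_restrict_of_ae ((hgT l).symm.trans hconst)),
      setIntegral_const, smul_eq_mul, mul_comm]
  rw [integral_indicator_const _ hS, smul_eq_mul, mul_one,
    measureReal_restrict_apply hS] at hset
  rw [← ENNReal.toReal_eq_toReal_iff' (by finiteness) (by finiteness), ENNReal.toReal_mul]
  exact hset

/-- **Generalized Basu theorem**: a generalized ancillary statistic is independent of any
generalized complete sufficient statistic under every deformed probability measure. -/
theorem generalized_basu
    {Ω Λ 𝒯 : Type*} [MeasurableSpace Ω] [MeasurableSpace 𝒯] [Nonempty Λ]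
    (ν : Measure Ω) [SigmaFinite ν]
    (L : Ω → Λ → ℝ) (hLmeas : ∀ l, Measurable fun ω => L ω l)
    (hLint : ∀ l, Integrable (fun ω => Real.exp (L ω l)) ν)
    (hLpos : ∀ l, 0 < ∫ ω, Real.exp (L ω l) ∂ν)
    (P : Λ → Measure Ω)
    (hP : ∀ l, P l = ν.withDensity fun ω =>
      ENNReal.ofReal (Real.exp (L ω l) / ∫ ω', Real.exp (L ω' l) ∂ν))
    (T : Ω → 𝒯) (hT : Measurable T)
    (hsuff : GenSufficient P T) (hcomp : GenComplete P T)
    (A : Ω → ℝ) (hA : Measurable A)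
    (hanc : ∀ (a : ℝ) (l₁ l₂ : Λ), P l₁ {ω | A ω ≤ a} = P l₂ {ω | A ω ≤ a}) :
    ∀ (l : Λ) (a : ℝ) (B : Set 𝒯), MeasurableSet B →
      P l ({ω | A ω ≤ a} ∩ T ⁻¹' B) = P l {ω | A ω ≤ a} * P l (T ⁻¹' B) := by
  have := fun l => isProbabilityMeasure_of_eq_withDensity_div (hLint l) (hLpos l) (hP l)
  intro l a B hB
  have hS : MeasurableSet {ω | A ω ≤ a} := measurableSet_le hA measurable_const
  exact hcomp.measure_inter_preimage_eq_mul hsuff hT hS (hanc a) l hB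
end

section
/- For every y₁ⁿ = (y₁, …, yₙ) ∈ Sⁿ and every λ ∈ Λ, exp(L_B^α(y₁ⁿ; λ)) = C(λ) · exp[(α/(α−1)) h̄(y₁ⁿ) + (α/(α−1)) Σᵢ₌₁ᵈ wᵢ(λ) f̄ᵢ(y₁ⁿ)], where C(λ) = exp[(α/(α−1)) Z(λ) − 1/(α−1) − ∫_S f_λ^α(y) dy] depends only on λ. In particular, the deformed joint density of an i.i.d. sample from the 𝔅^(α)-family has the exponential-family form N(λ) · exp[(α/(α−1)) h̄(y₁ⁿ)] · exp[Σᵢ wᵢ*(λ) f̄ᵢ(y₁ⁿ)] with wᵢ* = (α/(α−1)) wᵢ. -/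
open MeasureTheory

/-- The generalized likelihood `L_B^α` of an i.i.d. sample from a `𝔅^(α)`-family gives a
deformed joint density of exponential-family form: `exp (L_B^α (y; λ))` equals a
`λ`-dependent constant times
`exp ((α/(α-1)) h̄(y) + (α/(α-1)) Σᵢ wᵢ(λ) f̄ᵢ(y))`. -/
theorem bAlpha_deformed_density_exponential_form
    {Λ : Type*} [Nonempty Λ]
    (α : ℝ) (hα0 : 0 < α) (hα1 : α ≠ 1)
    (n : ℕ) (hn : 1 ≤ n) (d : ℕ)
    (S : Set ℝ) (hS : MeasurableSet S)
    (h : ℝ → ℝ) (f : Fin d → ℝ → ℝ) (w : Λ → Fin d → ℝ) (Z : Λ → ℝ)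
    (fl : Λ → ℝ → ℝ)
    (hfl : ∀ l y, fl l y = (h y + Z l + ∑ i, w l i * f i y) ^ (1 / (α - 1)))
    (hpos : ∀ l, ∀ y ∈ S, 0 < h y + Z l + ∑ i, w l i * f i y)
    (hpdf : ∀ l, ∫ y in S, fl l y = 1)
    (hint : ∀ l, IntegrableOn (fun y => fl l y ^ α) S)
    (LB : (Fin n → ℝ) → Λ → ℝ)
    (hLB : ∀ ys l, LB ys l =
      (1 / n) * ∑ j, (α * fl l (ys j) ^ (α - 1) - 1) / (α - 1) - ∫ y in S, fl l y ^ α) :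
    ∀ (ys : Fin n → ℝ), (∀ j, ys j ∈ S) → ∀ l,
      Real.exp (LB ys l) =
        Real.exp ((α / (α - 1)) * Z l - 1 / (α - 1) - ∫ y in S, fl l y ^ α) *
          Real.exp ((α / (α - 1)) * ((1 / n) * ∑ j, h (ys j)) +
            (α / (α - 1)) * ∑ i, w l i * ((1 / n) * ∑ j, f i (ys j))) := by
  intro ys hys l
  have hn' : (n : ℝ) ≠ 0 := by positivity
  have hα : α - 1 ≠ 0 := sub_ne_zero.mpr hα1
  have hpow (j : Fin n) :
      fl l (ys j) ^ (α - 1) = h (ys j) + Z l + ∑ i, w l i * f i (ys j) := by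
    rw [hfl, ← Real.rpow_mul (hpos l _ (hys j)).le, one_div_mul_cancel hα, Real.rpow_one]
  have hswap : ∑ i, w l i * ((1 / n) * ∑ j, f i (ys j)) =
      (1 / n) * ∑ j, ∑ i, w l i * f i (ys j) := by
    rw [Finset.sum_comm, Finset.mul_sum]
    refine Finset.sum_congr rfl fun i _ => ?_
    rw [← Finset.mul_sum]
    ring
  rw [← Real.exp_add, hLB, hswap]
  congr 1
  simp only [hpow, ← Finset.sum_div, Finset.sum_sub_distrib, ← Finset.mul_sum,
    Finset.sum_add_distrib, Finset.sum_const, Finset.card_univ, Fintype.card_fin, nsmul_eq_mul]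
  field_simp
  ring
end

section
/- Suppose the set {w(λ) : λ ∈ Λ} ⊆ ℝᵈ contains a nonempty open rectangle (a product of d nondegenerate open intervals). Then for all r, s ∈ Sⁿ, one has f̄^d(r) = f̄^d(s) if and only if the map λ ↦ L_B^α(r; λ) − L_B^α(s; λ) is constant on Λ; that is, f̄^d = (f̄₁, …, f̄_d) is a generalized minimal sufficient statistic for the 𝔅^(α)-family with respect to L_B^α. -/
open MeasureTheory

/-- The generalized likelihood of a `𝔅^(α)`-density is affine in `w`, with the sample means of
the `f i` as coefficients. -/
theorem bAlpha_mean_likelihood_eq {d n : ℕ} {α : ℝ} (hα1 : α ≠ 1) (hn : 1 ≤ n)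
    (h : ℝ → ℝ) (f : Fin d → ℝ → ℝ) (w : Fin d → ℝ) (z : ℝ) (y : Fin n → ℝ)
    (hpos : ∀ j, 0 < h (y j) + z + ∑ i, w i * f i (y j)) :
    (1 / n) * ∑ j, (α * ((h (y j) + z + ∑ i, w i * f i (y j)) ^ (1 / (α - 1))) ^ (α - 1) - 1)
        / (α - 1) =
      α / (α - 1) * ((1 / n) * ∑ j, h (y j) + z + ∑ i, w i * ((1 / n) * ∑ j, f i (y j)))
        - 1 / (α - 1) := by
  have hα : α - 1 ≠ 0 := sub_ne_zero.mpr hα1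
  have hn' : (n : ℝ) ≠ 0 := by positivity
  have hpow (j : Fin n) :
      ((h (y j) + z + ∑ i, w i * f i (y j)) ^ (1 / (α - 1))) ^ (α - 1) =
        h (y j) + z + ∑ i, w i * f i (y j) := by
    rw [one_div, Real.rpow_inv_rpow (hpos j).le hα]
  have hswap : ∑ i, w i * ((1 / n) * ∑ j, f i (y j)) =
      (1 / n) * ∑ j, ∑ i, w i * f i (y j) := by
    rw [Finset.sum_comm, Finset.mul_sum]
    refine Finset.sum_congr rfl fun i _ => ?_
    rw [← Finset.mul_sum]
    ring
  simp only [hpow, hswap]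
  rw [← Finset.sum_div, Finset.sum_sub_distrib, ← Finset.mul_sum, Finset.sum_add_distrib,
    Finset.sum_add_distrib]
  simp only [Finset.sum_const, Finset.card_univ, Fintype.card_fin, nsmul_eq_mul]
  field_simp

/-- **Generalized minimal sufficiency of `f̄^d` for the `𝔅^(α)`-family**: if the range of
`w` contains a nonempty open rectangle, then for samples `r, s ∈ Sⁿ` the vector of sample
means agrees at `r` and `s` exactly when `λ ↦ L_B^α(r; λ) − L_B^α(s; λ)` is constant. -/
theorem bAlpha_sample_mean_generalized_minimal_sufficient
    {Λ : Type*} [Nonempty Λ]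
    (α : ℝ) (hα0 : 0 < α) (hα1 : α ≠ 1)
    (n : ℕ) (hn : 1 ≤ n) (d : ℕ)
    (S : Set ℝ) (hS : MeasurableSet S)
    (h : ℝ → ℝ) (f : Fin d → ℝ → ℝ) (w : Λ → Fin d → ℝ) (Z : Λ → ℝ)
    (fl : Λ → ℝ → ℝ)
    (hfl : ∀ l y, fl l y = (h y + Z l + ∑ i, w l i * f i y) ^ (1 / (α - 1)))
    (hpos : ∀ l, ∀ y ∈ S, 0 < h y + Z l + ∑ i, w l i * f i y)
    (hpdf : ∀ l, ∫ y in S, fl l y = 1)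
    (hint : ∀ l, IntegrableOn (fun y => fl l y ^ α) S)
    (LB : (Fin n → ℝ) → Λ → ℝ)
    (hLB : ∀ ys l, LB ys l =
      (1 / n) * ∑ j, (α * fl l (ys j) ^ (α - 1) - 1) / (α - 1) - ∫ y in S, fl l y ^ α)
    (a b : Fin d → ℝ) (hab : ∀ i, a i < b i)
    (hrect : ∀ c : Fin d → ℝ, (∀ i, c i ∈ Set.Ioo (a i) (b i)) → ∃ l, w l = c) :
    ∀ r s : Fin n → ℝ, (∀ j, r j ∈ S) → (∀ j, s j ∈ S) →
      ((∀ i, (1 / n) * ∑ j, f i (r j) = (1 / n) * ∑ j, f i (s j)) ↔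
        ∀ l₁ l₂ : Λ, LB r l₁ - LB s l₁ = LB r l₂ - LB s l₂) := by
  intro r s hr hs
  have hdiff (l : Λ) : LB r l - LB s l =
      α / (α - 1) * ((1 / n) * ∑ j, h (r j) - (1 / n) * ∑ j, h (s j) +
        ∑ i, w l i * ((1 / n) * ∑ j, f i (r j) - (1 / n) * ∑ j, f i (s j))) := by
    rw [hLB, hLB]
    simp only [hfl]
    rw [bAlpha_mean_likelihood_eq hα1 hn h f (w l) (Z l) r fun j => hpos l _ (hr j),
      bAlpha_mean_likelihood_eq hα1 hn h f (w l) (Z l) s fun j => hpos l _ (hs j)]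
    simp only [mul_sub, Finset.sum_sub_distrib]
    ring
  constructor
  · intro hf l₁ l₂
    simp only [hdiff, hf, sub_self, mul_zero]
  · intro hconst i
    obtain ⟨l₁, h₁⟩ := hrect (fun k => (a k + b k) / 2) fun k =>
      ⟨by linarith [hab k], by linarith [hab k]⟩
    obtain ⟨l₂, h₂⟩ := hrect
      (fun k => (a k + b k) / 2 + if k = i then (b k - a k) / 4 else 0) fun k => by
        split_ifs <;> constructor <;> linarith [hab k]
    have hα : α / (α - 1) ≠ 0 := div_ne_zero hα0.ne' (sub_ne_zero.mpr hα1)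
    have key := hconst l₁ l₂
    rw [hdiff, hdiff, h₁, h₂] at key
    have key := add_left_cancel (mul_left_cancel₀ hα key)
    simp only [add_mul, Finset.sum_add_distrib, ite_mul, zero_mul, Finset.sum_ite_eq',
      Finset.mem_univ, if_true, left_eq_add] at key
    have hne : (b i - a i) / 4 ≠ 0 := (div_pos (sub_pos.mpr (hab i)) four_pos).ne'
    exact sub_eq_zero.mp ((mul_eq_zero.mp key).resolve_left hne)
end

section
/- Assume that for every integer i ≥ 0 the i-th deformed central moment u_i(λ) = ∫_ℝ (t − λ)^i g_λ(t) dμ(t) is finite, that for i ≥ 1 the map λ ↦ u_i(λ) is differentiable with derivative obtained by differentiating under the integral sign, and that ∫_ℝ (∂/∂λ) g_λ(t) dμ(t) = 0 for all λ. Then u₀ ≡ 1, u₁ ≡ 0 (equivalently ∫ t g_λ(t) dμ(t) = λ), and for every i ≥ 1 and every λ ∈ Λ, u_i'(λ) = −i u_{i−1}(λ) + n w*'(λ) u_{i+1}(λ). -/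
open MeasureTheory

/-- **Lemma 5.1 (central moments of the deformed density of `T`)**: for the deformed density
`g_λ(t) = N(λ) exp(k*(t) + n w*(λ) t)` satisfying the regularity condition
`(log N)'(λ) + n λ w*'(λ) = 0`, one has `u₀ ≡ 1`, `u₁ ≡ 0` (equivalently the deformed mean of
`T` is `λ`), and the central moments satisfy the recursion
`uᵢ'(λ) = -i u_{i-1}(λ) + n w*'(λ) u_{i+1}(λ)`. -/
theorem deformed_central_moment_recursion
    (Λ : Set ℝ) (hΛne : Λ.Nonempty) (hΛopen : IsOpen Λ) (hΛconn : Λ.OrdConnected)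
    (μ : Measure ℝ) [SigmaFinite μ]
    (n : ℕ) (hn : 1 ≤ n)
    (k : ℝ → ℝ) (hk : Measurable k)
    (W W' N N' : ℝ → ℝ)
    (hW : ∀ l ∈ Λ, HasDerivAt W (W' l) l) (hWpos : ∀ l ∈ Λ, 0 < W' l)
    (hN : ∀ l ∈ Λ, HasDerivAt N (N' l) l) (hNpos : ∀ l ∈ Λ, 0 < N l)
    (g : ℝ → ℝ → ℝ)
    (hg : ∀ l t, g l t = N l * Real.exp (k t + n * W l * t))
    (hpdf : ∀ l ∈ Λ, ∫ t, g l t ∂μ = 1)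
    (hreg : ∀ l ∈ Λ, N' l / N l + n * l * W' l = 0)
    (u : ℕ → ℝ → ℝ)
    (hu : ∀ i l, u i l = ∫ t, (t - l) ^ i * g l t ∂μ)
    (hfin : ∀ (i : ℕ), ∀ l ∈ Λ, Integrable (fun t => (t - l) ^ i * g l t) μ)
    (hdiff : ∀ i : ℕ, 1 ≤ i → ∀ l ∈ Λ,
      HasDerivAt (u i)
        (∫ t, (-(i : ℝ)) * (t - l) ^ (i - 1) * g l t +
          (t - l) ^ i * ((N' l + N l * (n * W' l * t)) * Real.exp (k t + n * W l * t)) ∂μ) l)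
    (hzero : ∀ l ∈ Λ,
      ∫ t, (N' l + N l * (n * W' l * t)) * Real.exp (k t + n * W l * t) ∂μ = 0) :
    (∀ l ∈ Λ, u 0 l = 1) ∧
    (∀ l ∈ Λ, u 1 l = 0) ∧
    (∀ l ∈ Λ, ∫ t, t * g l t ∂μ = l) ∧
    (∀ i : ℕ, 1 ≤ i → ∀ l ∈ Λ,
      HasDerivAt (u i) (-(i : ℝ) * u (i - 1) l + n * W' l * u (i + 1) l) l) := by
  have score : ∀ l ∈ Λ, ∀ t,
      (N' l + N l * (n * W' l * t)) * Real.exp (k t + n * W l * t) =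
        n * W' l * ((t - l) * g l t) := by
    intro l hl t
    have hN0 : N l ≠ 0 := (hNpos l hl).ne'
    have hN' : N' l = -(n * l * W' l * N l) := by
      have h := hreg l hl
      field_simp at h
      linarith
    rw [hg, hN']
    ring
  have u_zero : ∀ l ∈ Λ, u 0 l = 1 := fun l hl => by simpa [hu] using hpdf l hl
  have u_one : ∀ l ∈ Λ, u 1 l = 0 := by
    intro l hl
    have h := hzero l hl
    simp only [score l hl, integral_const_mul] at h
    have hn0 : (n : ℝ) ≠ 0 := by exact_mod_cast (by omega : n ≠ 0)
    rw [hu]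
    simpa [hn0, (hWpos l hl).ne'] using h
  refine ⟨u_zero, u_one, fun l hl => ?_, fun i hi l hl => ?_⟩
  · have split : ∀ t, t * g l t = (t - l) ^ 1 * g l t + l * ((t - l) ^ 0 * g l t) :=
      fun t => by ring
    simp only [split]
    rw [integral_add (hfin 1 l hl) ((hfin 0 l hl).const_mul l), integral_const_mul,
      ← hu, ← hu, u_zero l hl, u_one l hl]
    ring
  · convert hdiff i hi l hl using 1
    have split : ∀ t, (-(i : ℝ)) * (t - l) ^ (i - 1) * g l t +
        (t - l) ^ i * ((N' l + N l * (n * W' l * t)) * Real.exp (k t + n * W l * t)) =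
        -(i : ℝ) * ((t - l) ^ (i - 1) * g l t) + n * W' l * ((t - l) ^ (i + 1) * g l t) := by
      intro t
      rw [score l hl]
      ring
    simp only [split]
    rw [integral_add ((hfin (i - 1) l hl).const_mul _) ((hfin (i + 1) l hl).const_mul _),
      integral_const_mul, integral_const_mul, ← hu, ← hu]
end

section
/- Let Λ ⊆ ℝ be open, n ≥ 1, and let w* : Λ → ℝ be three times differentiable with w*'(λ) > 0 on Λ. Suppose u₀, u₁, u₂, u₃, u₄, u₅ : Λ → ℝ satisfy u₀ ≡ 1, u₁ ≡ 0, u₁, u₂, u₃ are differentiable, and the recursion u_i'(λ) = −i u_{i−1}(λ) + n w*'(λ) u_{i+1}(λ) holds for i = 1, 2, 3 and all λ ∈ Λ. Then for all λ ∈ Λ: u₂(λ) = 1/(n w*'(λ)), u₃(λ) = −w*''(λ)/(n² w*'(λ)³), and u₄(λ) = 3/(n w*'(λ))² + [3 (w*''(λ)/w*'(λ))² − w*'''(λ)/w*'(λ)] / (n w*'(λ))³. -/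
/-- Two functions agreeing on an open set have the same derivatives there. -/
theorem HasDerivAt.unique_of_eqOn_isOpen {s : Set ℝ} (hs : IsOpen s) {f g : ℝ → ℝ}
    (hfg : Set.EqOn f g s) {x f' g' : ℝ} (hx : x ∈ s)
    (hf : HasDerivAt f f' x) (hg : HasDerivAt g g' x) : f' = g' :=
  hf.unique (hg.congr_of_eventuallyEq (hfg.eventuallyEq_of_mem (hs.mem_nhds hx)))

/-- Closed-form expressions (equations (2.E56)–(2.E58)) for the central moments `u₂, u₃, u₄`
obtained from the recursion `uᵢ' = -i u_{i-1} + n w*' u_{i+1}` of Lemma 5.1, together with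
`u₀ ≡ 1` and `u₁ ≡ 0`. -/
theorem deformed_central_moments_closed_form
    (Λ : Set ℝ) (hΛopen : IsOpen Λ)
    (n : ℕ) (hn : 1 ≤ n)
    (W W1 W2 W3 : ℝ → ℝ)
    (hW1 : ∀ l ∈ Λ, HasDerivAt W (W1 l) l)
    (hW2 : ∀ l ∈ Λ, HasDerivAt W1 (W2 l) l)
    (hW3 : ∀ l ∈ Λ, HasDerivAt W2 (W3 l) l)
    (hWpos : ∀ l ∈ Λ, 0 < W1 l)
    (u : ℕ → ℝ → ℝ)
    (hu0 : ∀ l ∈ Λ, u 0 l = 1)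
    (hu1 : ∀ l ∈ Λ, u 1 l = 0)
    (hrec : ∀ i ∈ ({1, 2, 3} : Set ℕ), ∀ l ∈ Λ,
      HasDerivAt (u i) (-(i : ℝ) * u (i - 1) l + n * W1 l * u (i + 1) l) l) :
    ∀ l ∈ Λ,
      u 2 l = 1 / (n * W1 l) ∧
      u 3 l = -W2 l / (n ^ 2 * W1 l ^ 3) ∧
      u 4 l = 3 / (n * W1 l) ^ 2 +
        (3 * (W2 l / W1 l) ^ 2 - W3 l / W1 l) / (n * W1 l) ^ 3 := by
  have hn0 : (n : ℝ) ≠ 0 := by positivity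
  have hW0 : ∀ l ∈ Λ, W1 l ≠ 0 := fun l hl => (hWpos l hl).ne'
  have hu2 : ∀ l ∈ Λ, u 2 l = 1 / (n * W1 l) := by
    intro l hl
    have h := HasDerivAt.unique_of_eqOn_isOpen hΛopen hu1 hl (hrec 1 (by simp) l hl)
      (hasDerivAt_const l 0)
    have h0 := hW0 l hl
    norm_num [hu0 l hl] at h
    field_simp
    linarith
  have hu3 : ∀ l ∈ Λ, u 3 l = -W2 l / (n ^ 2 * W1 l ^ 3) := by
    intro l hl
    have h0 := hW0 l hl
    have h := HasDerivAt.unique_of_eqOn_isOpen hΛopen hu2 hl (hrec 2 (by simp) l hl)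
      ((hasDerivAt_const l 1).fun_div ((hW2 l hl).const_mul (n : ℝ)) (mul_ne_zero hn0 h0))
    norm_num [hu1 l hl] at h
    field_simp at h ⊢
    linarith
  intro l hl
  refine ⟨hu2 l hl, hu3 l hl, ?_⟩
  have h0 := hW0 l hl
  have h := HasDerivAt.unique_of_eqOn_isOpen hΛopen hu3 hl (hrec 3 (by simp) l hl)
    ((hW3 l hl).fun_neg.fun_div (((hW2 l hl).fun_pow 3).const_mul ((n : ℝ) ^ 2))
      (mul_ne_zero (pow_ne_zero 2 hn0) (pow_ne_zero 3 h0)))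
  norm_num [hu2 l hl] at h
  field_simp at h ⊢
  linarith
end

section
/- For λ ∈ (0, 1), define a probability mass function on {0,1}³ by f̃_λ(y₁, y₂, y₃) = (1 + ȳ (2λ−1)/(1−λ)) / Σ_{(r₁,r₂,r₃) ∈ {0,1}³} (1 + r̄ (2λ−1)/(1−λ)), where ȳ = (y₁+y₂+y₃)/3 and r̄ = (r₁+r₂+r₃)/3, and define h(t) = (−1)^{3t} · (3t/2) for t ∈ {0, 1/3, 2/3, 1}. Then: (i) Σ_{y ∈ {0,1}³} h(ȳ) f̃_λ(y) = 0 for every λ ∈ (0,1); (ii) Σ_{y ∈ {0,1}³ : h(ȳ) = 0} f̃_λ(y) = (1−λ)/4 < 1 for every λ ∈ (0,1). Consequently, the statistic T(y₁,y₂,y₃) = ȳ is not generalized complete for this family. -/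
/-- A function of the number of ones is summed over `{0,1}³` by grouping with binomial weights. -/
theorem sum_comp_count_ones (g : ℕ → ℝ) :
    ∑ y : Fin 3 → Fin 2, g (∑ j, (y j : ℕ)) = g 0 + 3 * g 1 + 3 * g 2 + g 3 := by
  have hcounts : (Finset.univ : Finset (Fin 3 → Fin 2)).val.map (fun y => ∑ j, (y j : ℕ)) =
      {0, 1, 1, 1, 2, 2, 2, 3} := by decide
  have hsum : ∑ y : Fin 3 → Fin 2, g (∑ j, (y j : ℕ)) =
      (((Finset.univ : Finset (Fin 3 → Fin 2)).val.map fun y => ∑ j, (y j : ℕ)).map g).sum := by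
    rw [Multiset.map_map]
    rfl
  rw [hsum, hcounts]
  simp only [Multiset.insert_eq_cons, Multiset.map_cons, Multiset.map_singleton,
    Multiset.sum_cons, Multiset.sum_singleton]
  ring

/-- The normalizing constant of the deformed distribution is `4 / (1 - l)`. -/
theorem deformed_density_eq {l : ℝ} (hl : l < 1) (t : ℝ) :
    (1 + t * (2 * l - 1) / (1 - l)) /
        ∑ r : Fin 3 → Fin 2, (1 + ((∑ j, ((r j : ℕ) : ℝ)) / 3) * (2 * l - 1) / (1 - l)) =
      (1 - l + t * (2 * l - 1)) / 4 := by
  have hne : 1 - l ≠ 0 := by linarith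
  have hsum := sum_comp_count_ones fun n => 1 + ((n : ℝ) / 3) * (2 * l - 1) / (1 - l)
  push_cast at hsum
  have hnorm : ∑ r : Fin 3 → Fin 2, (1 + ((∑ j, ((r j : ℕ) : ℝ)) / 3) * (2 * l - 1) / (1 - l)) =
      4 / (1 - l) := by
    rw [hsum]
    field_simp
    ring
  rw [hnorm]
  field_simp


open scoped Classical in
/-- **Example 5.2**: for the deformed distribution `f̃_λ` of a sample of size 3 from the
Bernoulli member of the `ℳ^(α)`-family (α = 2) and `h(t) = (−1)^{3t}·(3t/2)`, the deformed
expectation of `h(ȳ)` vanishes for every `λ ∈ (0,1)` while `P̃_λ(h(ȳ) = 0) = (1−λ)/4 < 1`;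
consequently the sample mean `ȳ` is not generalized complete for this family. -/
theorem mAlpha_sample_mean_not_generalized_complete
    (ft : ℝ → (Fin 3 → Fin 2) → ℝ)
    (hft : ∀ l y, ft l y =
      (1 + ((∑ j, ((y j : ℕ) : ℝ)) / 3) * (2 * l - 1) / (1 - l)) /
        ∑ r : Fin 3 → Fin 2, (1 + ((∑ j, ((r j : ℕ) : ℝ)) / 3) * (2 * l - 1) / (1 - l)))
    (H : (Fin 3 → Fin 2) → ℝ)
    (hH : ∀ y, H y = (-1 : ℝ) ^ (∑ j, (y j : ℕ)) * (3 * ((∑ j, ((y j : ℕ) : ℝ)) / 3) / 2)) :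
    (∀ l ∈ Set.Ioo (0 : ℝ) 1, ∑ y : Fin 3 → Fin 2, H y * ft l y = 0) ∧
    (∀ l ∈ Set.Ioo (0 : ℝ) 1,
      (∑ y ∈ Finset.univ.filter fun y : Fin 3 → Fin 2 => H y = 0, ft l y) = (1 - l) / 4 ∧
        (1 - l) / 4 < 1) ∧
    ¬ (∀ h' : ℝ → ℝ,
        (∀ l ∈ Set.Ioo (0 : ℝ) 1,
          ∑ y : Fin 3 → Fin 2, h' ((∑ j, ((y j : ℕ) : ℝ)) / 3) * ft l y = 0) →
        ∀ l ∈ Set.Ioo (0 : ℝ) 1,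
          (∑ y ∈ Finset.univ.filter
            fun y : Fin 3 → Fin 2 => h' ((∑ j, ((y j : ℕ) : ℝ)) / 3) = 0, ft l y) = 1) := by
  have hdens : ∀ l ∈ Set.Ioo (0 : ℝ) 1, ∀ y, ft l y =
      (1 - l + ((∑ j, (y j : ℕ) : ℕ) : ℝ) / 3 * (2 * l - 1)) / 4 := by
    intro l hl y
    rw [hft, deformed_density_eq hl.2]
    push_cast
    rfl
  have hcount : ∀ y, H y = (-1 : ℝ) ^ (∑ j, (y j : ℕ)) * (((∑ j, (y j : ℕ) : ℕ) : ℝ) / 2) := by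
    intro y
    rw [hH]
    push_cast
    ring
  have hmean : ∀ l ∈ Set.Ioo (0 : ℝ) 1, ∑ y : Fin 3 → Fin 2, H y * ft l y = 0 := by
    intro l hl
    simp only [hcount, hdens l hl]
    rw [sum_comp_count_ones fun n =>
      (-1 : ℝ) ^ n * ((n : ℝ) / 2) * ((1 - l + (n : ℝ) / 3 * (2 * l - 1)) / 4)]
    push_cast
    ring
  have hzero : ∀ l ∈ Set.Ioo (0 : ℝ) 1,
      (∑ y ∈ Finset.univ.filter fun y : Fin 3 → Fin 2 => H y = 0, ft l y) = (1 - l) / 4 := by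
    intro l hl
    rw [Finset.sum_filter]
    simp only [hcount, hdens l hl]
    rw [sum_comp_count_ones fun n => if (-1 : ℝ) ^ n * ((n : ℝ) / 2) = 0 then
      (1 - l + (n : ℝ) / 3 * (2 * l - 1)) / 4 else 0]
    norm_num
  refine ⟨hmean, fun l hl => ⟨hzero l hl, by linarith [hl.1]⟩, fun hcomplete => ?_⟩
  have hfactor : ∀ y : Fin 3 → Fin 2,
      (fun t : ℝ => (-1 : ℝ) ^ ⌊3 * t⌋₊ * (3 * t / 2)) ((∑ j, ((y j : ℕ) : ℝ)) / 3) = H y := by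
    intro y
    have hfloor : ⌊3 * ((∑ j, ((y j : ℕ) : ℝ)) / 3)⌋₊ = ∑ j, (y j : ℕ) := by
      rw [mul_div_cancel₀ _ (three_ne_zero' ℝ), ← Nat.cast_sum, Nat.floor_natCast]
    simp only [hfloor, hH]
  have hhalf : (1 / 2 : ℝ) ∈ Set.Ioo (0 : ℝ) 1 := by norm_num
  have hone := hcomplete (fun t => (-1 : ℝ) ^ ⌊3 * t⌋₊ * (3 * t / 2))
    (fun l hl => by simpa only [hfactor] using hmean l hl) _ hhalf
  simp only [hfactor] at hone
  rw [hzero _ hhalf] at hone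
  norm_num at hone
end

section
/- For λ ∈ (0, 1), define a probability mass function on {0,1}² by f̃_λ(y₁, y₂) = ((1−λ)/2) · (1 + ȳ (2λ−1)/(1−λ)), where ȳ = (y₁+y₂)/2, and define η(0,0) = η(1,1) = 1 and η(0,1) = η(1,0) = −1. Then: (i) f̃_λ is a probability mass function on {0,1}² for every λ ∈ (0,1); (ii) Σ_{y ∈ {0,1}²} η(y) f̃_λ(y) = 0 for every λ ∈ (0,1); (iii) Σ_{y ∈ {0,1}²} η(y) · ȳ · f̃_λ(y) = (1/2)(λ − 1/2), which is nonzero for λ ≠ 1/2. Consequently, the sample mean Ȳ is not the generalized UMVUE of its deformed expectation for this family. -/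
theorem sum_fin_two_fun_fin_two {M : Type*} [AddCommMonoid M] (g : (Fin 2 → Fin 2) → M) :
    ∑ y, g y = g ![0, 0] + g ![0, 1] + (g ![1, 0] + g ![1, 1]) := by
  rw [← (finTwoArrowEquiv (Fin 2)).symm.sum_comp g, Fintype.sum_prod_type]
  simp [Fin.sum_univ_two, finTwoArrowEquiv]

/-- **Example 5.3**: for the deformed distribution `f̃_λ` of a sample of size 2 from the
Bernoulli member of the `ℳ^(α)`-family (α = 2), the function `η` (equal to `1` on diagonal
pairs and `−1` off the diagonal) is a generalized unbiased estimator of zero, yet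
`Ẽ_λ[η·Ȳ] = (1/2)(λ − 1/2) ≠ 0` for `λ ≠ 1/2`; consequently the sample mean `Ȳ` fails the
orthogonality characterization and is not the generalized UMVUE of its deformed
expectation. -/
theorem mAlpha_sample_mean_not_generalized_umvue
    (ft : ℝ → (Fin 2 → Fin 2) → ℝ)
    (hft : ∀ l y, ft l y =
      ((1 - l) / 2) * (1 + ((∑ j, ((y j : ℕ) : ℝ)) / 2) * (2 * l - 1) / (1 - l)))
    (η : (Fin 2 → Fin 2) → ℝ)
    (hη : ∀ y, η y = if y 0 = y 1 then (1 : ℝ) else -1) :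
    (∀ l ∈ Set.Ioo (0 : ℝ) 1,
      (∀ y, 0 ≤ ft l y) ∧ ∑ y : Fin 2 → Fin 2, ft l y = 1) ∧
    (∀ l ∈ Set.Ioo (0 : ℝ) 1, ∑ y : Fin 2 → Fin 2, η y * ft l y = 0) ∧
    (∀ l ∈ Set.Ioo (0 : ℝ) 1,
      (∑ y : Fin 2 → Fin 2, η y * ((∑ j, ((y j : ℕ) : ℝ)) / 2) * ft l y)
          = (1 / 2) * (l - 1 / 2) ∧
        (l ≠ 1 / 2 → (1 / 2) * (l - 1 / 2) ≠ 0)) ∧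
    ¬ (∀ w : (Fin 2 → Fin 2) → ℝ,
        (∀ l ∈ Set.Ioo (0 : ℝ) 1, ∑ y : Fin 2 → Fin 2, w y * ft l y = 0) →
        ∀ l ∈ Set.Ioo (0 : ℝ) 1,
          ∑ y : Fin 2 → Fin 2, w y * ((∑ j, ((y j : ℕ) : ℝ)) / 2) * ft l y = 0) := by
  have hval : ∀ l ∈ Set.Ioo (0 : ℝ) 1, ft l ![0, 0] = (1 - l) / 2 ∧ ft l ![0, 1] = 1 / 4 ∧
      ft l ![1, 0] = 1 / 4 ∧ ft l ![1, 1] = l / 2 := by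
    intro l hl
    have h : 1 - l ≠ 0 := by linarith [hl.2]
    refine ⟨?_, ?_, ?_, ?_⟩ <;> simp [hft, Fin.sum_univ_two] <;> field_simp <;> ring
  have hzero : ∀ l ∈ Set.Ioo (0 : ℝ) 1, ∑ y : Fin 2 → Fin 2, η y * ft l y = 0 := by
    intro l hl
    obtain ⟨h00, h01, h10, h11⟩ := hval l hl
    rw [sum_fin_two_fun_fin_two, h00, h01, h10, h11]
    simp [hη]
    ring
  have hmean : ∀ l ∈ Set.Ioo (0 : ℝ) 1,
      (∑ y : Fin 2 → Fin 2, η y * ((∑ j, ((y j : ℕ) : ℝ)) / 2) * ft l y)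
        = (1 / 2) * (l - 1 / 2) := by
    intro l hl
    obtain ⟨h00, h01, h10, h11⟩ := hval l hl
    rw [sum_fin_two_fun_fin_two, h00, h01, h10, h11]
    simp [hη, Fin.sum_univ_two]
    ring
  refine ⟨fun l hl => ?_, hzero, fun l hl => ⟨hmean l hl, fun hne => ?_⟩, fun H => ?_⟩
  · obtain ⟨h00, h01, h10, h11⟩ := hval l hl
    constructor
    · intro y
      have hy : y = ![y 0, y 1] := by ext i; fin_cases i <;> rfl
      rw [hy]
      generalize y 0 = a
      generalize y 1 = b
      fin_cases a <;> fin_cases b <;> simp [h00, h01, h10, h11] <;> linarith [hl.1, hl.2]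
    · rw [sum_fin_two_fun_fin_two, h00, h01, h10, h11]
      ring
  · exact mul_ne_zero (by norm_num) (sub_ne_zero.mpr hne)
  · have hl : (3 / 4 : ℝ) ∈ Set.Ioo (0 : ℝ) 1 := by constructor <;> norm_num
    have h := H η hzero _ hl
    rw [hmean _ hl] at h
    norm_num at h
end

section
/- Let ν > 2 be a real number, set α = (ν−1)/(ν+1) and K = Γ((ν+1)/2) / (Γ(ν/2) √(πν)), and for μ ∈ ℝ let f_μ(y) = K · [1 + (y−μ)²/ν]^{−(ν+1)/2} be the Student density with location μ and scale 1. For n ≥ 1 let ℓ_B^α(y₁ⁿ; μ) = Σⱼ₌₁ⁿ (α f_μ^{α−1}(yⱼ) − 1)/(α − 1) − n ∫_ℝ f_μ^α(y) dy, and set σ* = [ (ν−1) ν^{−(1+α)/2} (Γ((ν+1)/2)/(Γ(ν/2)√π))^{α−1} ]^{−1/2}, equivalently 1/σ*² = (ν−1) K^{α−1} / ν. Then there exists a constant C > 0, depending only on n and ν (and not on μ or y₁ⁿ), such that exp(ℓ_B^α(y₁ⁿ; μ)) = C · exp[ −(1/2) Σⱼ₌₁ⁿ ((yⱼ − μ)/σ*)²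 ] for all y₁ⁿ ∈ ℝⁿ and μ ∈ ℝ. Consequently, the deformed distribution of the sample associated with ℓ_B^α is the n-fold product of the normal distribution N(μ, σ*²). -/
open MeasureTheory

/-- The power `-2 / (ν + 1)` of the Student kernel is a quadratic polynomial. -/
lemma student_rpow {K ν u : ℝ} (hK : 0 ≤ K) (hν : 0 < ν) :
    (K * (1 + u ^ 2 / ν) ^ (-((ν + 1) / 2))) ^ (-2 / (ν + 1)) =
      K ^ (-2 / (ν + 1)) * (1 + u ^ 2 / ν) := by
  have hu : 0 ≤ 1 + u ^ 2 / ν := by positivity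
  have he : -((ν + 1) / 2) * (-2 / (ν + 1)) = 1 := by field_simp
  rw [Real.mul_rpow hK (Real.rpow_nonneg hu _), ← Real.rpow_mul hu, he, Real.rpow_one]

/-- For the Student `𝔅^(α)`-family (ν > 2 degrees of freedom, location `μ`, unit scale,
`α = (ν−1)/(ν+1)`), the exponential of the density-power-divergence likelihood `ℓ_B^α`
equals a constant `C > 0` (depending only on `n` and `ν`) times
`exp(−(1/2) Σⱼ ((yⱼ−μ)/σ*)²)`, where `1/σ*² = (ν−1) K^{α−1}/ν`; consequently the deformed
distribution of the sample is the `n`-fold product of `N(μ, σ*²)`. -/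
theorem student_deformed_distribution_is_gaussian
    (ν : ℝ) (hν : 2 < ν)
    (α : ℝ) (hα : α = (ν - 1) / (ν + 1))
    (K : ℝ) (hK : K = Real.Gamma ((ν + 1) / 2) /
      (Real.Gamma (ν / 2) * Real.sqrt (Real.pi * ν)))
    (f : ℝ → ℝ → ℝ)
    (hf : ∀ μ y, f μ y = K * (1 + (y - μ) ^ 2 / ν) ^ (-((ν + 1) / 2)))
    (n : ℕ) (hn : 1 ≤ n)
    (ℓ : (Fin n → ℝ) → ℝ → ℝ)
    (hℓ : ∀ ys μ, ℓ ys μ =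
      ∑ j, (α * f μ (ys j) ^ (α - 1) - 1) / (α - 1) - n * ∫ y, f μ y ^ α)
    (σs : ℝ) (hσs : 0 < σs)
    (hσ : 1 / σs ^ 2 = (ν - 1) * K ^ (α - 1) / ν) :
    ∃ C > (0 : ℝ), ∀ (ys : Fin n → ℝ) (μ : ℝ),
      Real.exp (ℓ ys μ) = C * Real.exp (-(1 / 2) * ∑ j, ((ys j - μ) / σs) ^ 2) := by
  have hK0 : 0 < K := by
    rw [hK]
    have := Real.Gamma_pos_of_pos (show 0 < (ν + 1) / 2 by linarith)
    have := Real.Gamma_pos_of_pos (show 0 < ν / 2 by linarith)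
    have : 0 < Real.pi * ν := mul_pos Real.pi_pos (by linarith)
    positivity
  have hν1 : ν + 1 ≠ 0 := by linarith
  have hν0 : ν ≠ 0 := by linarith
  have hα1 : α - 1 = -2 / (ν + 1) := by rw [hα]; field_simp; ring
  have hpow (μ y : ℝ) : f μ y ^ (α - 1) = K ^ (α - 1) * (1 + (y - μ) ^ 2 / ν) := by
    rw [hf, hα1, student_rpow hK0.le (by linarith)]
  have hint (μ : ℝ) : ∫ y, f μ y ^ α = ∫ y, f 0 y ^ α := by
    rw [← integral_sub_right_eq_self (fun y => f 0 y ^ α) μ]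
    simp only [hf, sub_zero]
  refine ⟨Real.exp (n * (-((ν - 1) / 2) * K ^ (α - 1) + (ν + 1) / 2 - ∫ y, f 0 y ^ α)),
    Real.exp_pos _, fun ys μ => ?_⟩
  have hterm (y : ℝ) : (α * f μ y ^ (α - 1) - 1) / (α - 1) =
      (-((ν - 1) / 2) * K ^ (α - 1) + (ν + 1) / 2) + -(1 / 2) * ((y - μ) / σs) ^ 2 := by
    have hsq : ((y - μ) / σs) ^ 2 = (y - μ) ^ 2 * ((ν - 1) * K ^ (α - 1) / ν) := by
      rw [← hσ]; ring
    rw [hpow, hsq]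
    generalize K ^ (α - 1) = k
    rw [hα1, hα]
    field_simp
    ring
  rw [← Real.exp_add, hℓ, hint]
  simp only [hterm, Finset.sum_add_distrib, Finset.sum_const, Finset.card_univ, Fintype.card_fin,
    nsmul_eq_mul, ← Finset.mul_sum]
  congr 1
  ring
end

section
/- Let n ≥ 1 be an integer, σ* > 0, μ ∈ ℝ, and let Ȳ be a random variable with the normal distribution N(μ, σ*²/n). Let Φ denote the cumulative distribution function of the standard normal distribution. Then E[ Φ( (√n / (√(2n−1) σ*)) · Ȳ ) ] = Φ( μ / (√2 σ*) ). -/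
open MeasureTheory ProbabilityTheory

/-- The measure of a lower half-line under `N(m, v)`, in terms of the standard normal. -/
lemma gaussianReal_Iic (m : ℝ) {v : NNReal} (hv : v ≠ 0) (x : ℝ) :
    gaussianReal m v (Set.Iic x) = gaussianReal 0 1 (Set.Iic ((x - m) / Real.sqrt v)) := by
  have hs : 0 < Real.sqrt v := Real.sqrt_pos.2 (NNReal.coe_pos.2 (pos_iff_ne_zero.2 hv))
  have hmap : (gaussianReal m v).map (fun y ↦ (y - m) / Real.sqrt v) = gaussianReal 0 1 := by
    have hcomp : (fun y : ℝ ↦ (y - m) / Real.sqrt v) =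
        (fun y ↦ y / Real.sqrt v) ∘ (fun y ↦ y - m) := rfl
    rw [hcomp, ← Measure.map_map (by fun_prop) (by fun_prop), gaussianReal_map_sub_const,
      gaussianReal_map_div_const, sub_self, zero_div]
    congr 1
    ext
    simp [hv]
  rw [← hmap, Measure.map_apply (by fun_prop) measurableSet_Iic]
  congr 1
  ext y
  simp [div_le_div_iff_of_pos_right hs]

/-- The average of the standard normal distribution function under `N(m, v)`. -/
lemma lintegral_gaussianReal_Iic (m : ℝ) (v : NNReal) :
    ∫⁻ x, gaussianReal 0 1 (Set.Iic x) ∂gaussianReal m v =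
      gaussianReal 0 1 (Set.Iic (m / Real.sqrt (v + 1))) := by
  have hconv : gaussianReal (-m) (v + 1) (Set.Iic 0) =
      ∫⁻ x, gaussianReal 0 1 (Set.Iic (-x)) ∂gaussianReal (-m) v := by
    have h := gaussianReal_conv_gaussianReal (m₁ := -m) (m₂ := 0) (v₁ := v) (v₂ := 1)
    rw [add_zero] at h
    rw [← h, Measure.conv, Measure.map_apply (by fun_prop) measurableSet_Iic,
      Measure.prod_apply (measurableSet_Iic.preimage (by fun_prop))]
    congr 1 with x
    congr 1
    ext y
    simp [le_neg_iff_add_nonpos_left]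
  have hmeas : Measurable fun x : ℝ ↦ gaussianReal 0 1 (Set.Iic x) :=
    (show Monotone fun x : ℝ ↦ gaussianReal 0 1 (Set.Iic x) from
      fun _ _ h ↦ measure_mono (Set.Iic_subset_Iic.2 h)).measurable
  have hneg : ∫⁻ x, gaussianReal 0 1 (Set.Iic (-x)) ∂gaussianReal (-m) v =
      ∫⁻ x, gaussianReal 0 1 (Set.Iic x) ∂gaussianReal m v := by
    rw [← gaussianReal_map_neg,
      lintegral_map (f := fun x : ℝ ↦ gaussianReal 0 1 (Set.Iic (-x)))
        (hmeas.comp measurable_neg) measurable_neg]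
    simp
  rw [← hneg, ← hconv, gaussianReal_Iic _ (by positivity)]
  simp

/-- If `Ȳ ∼ N(μ, σ*²/n)`, then `E[Φ((√n/(√(2n−1) σ*)) Ȳ)] = Φ(μ/(√2 σ*))`, where `Φ` is the
standard normal CDF: `Φ((√n/(√(2n−1)σ*)) Ȳ)` is a generalized unbiased estimator (and hence,
being a function of the generalized complete sufficient statistic `Ȳ`, the generalized
UMVUE) of the stress–strength reliability `Φ(μ/(√2 σ*))`. -/
theorem generalized_unbiased_estimator_stress_strength
    (n : ℕ) (hn : 1 ≤ n) (σs : ℝ) (hσs : 0 < σs) (μ : ℝ)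
    {Ω : Type*} [MeasurableSpace Ω] (P : Measure Ω) [IsProbabilityMeasure P]
    (Y : Ω → ℝ) (hY : Measurable Y)
    (v : NNReal) (hv : (v : ℝ) = σs ^ 2 / n)
    (hmap : P.map Y = gaussianReal μ v)
    (Φ : ℝ → ℝ)
    (hΦ : ∀ x, Φ x = ((gaussianReal 0 1) (Set.Iic x)).toReal) :
    ∫ ω, Φ ((Real.sqrt n / (Real.sqrt (2 * n - 1) * σs)) * Y ω) ∂P
      = Φ (μ / (Real.sqrt 2 * σs)) := by
  have hmono : Monotone fun x : ℝ ↦ gaussianReal 0 1 (Set.Iic x) :=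
    fun _ _ h ↦ measure_mono (Set.Iic_subset_Iic.2 h)
  have hn1 : (1 : ℝ) ≤ n := by exact_mod_cast hn
  have hk : (0 : ℝ) < 2 * n - 1 := by linarith
  simp only [hΦ]
  set c := Real.sqrt n / (Real.sqrt (2 * n - 1) * σs) with hc
  have hcY : P.map (fun ω ↦ c * Y ω) = gaussianReal (c * μ) (NNReal.mk (c ^ 2) (sq_nonneg c) * v) := by
    rw [← gaussianReal_map_const_mul, ← hmap, Measure.map_map (by fun_prop) hY]
    rfl
  have hvar : ((NNReal.mk (c ^ 2) (sq_nonneg c) * v : NNReal) : ℝ) = 1 / (2 * n - 1) := by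
    rw [NNReal.coe_mul, NNReal.coe_mk, hv, hc, div_pow, mul_pow, Real.sq_sqrt (by positivity),
      Real.sq_sqrt hk.le]
    field_simp
  have hmean : c * μ / Real.sqrt (1 / (2 * n - 1) + 1) = μ / (Real.sqrt 2 * σs) := by
    have h : (1 : ℝ) / (2 * n - 1) + 1 = 2 * n / (2 * n - 1) := by
      field_simp
      ring
    have h1 : 0 < Real.sqrt (2 * n - 1) := Real.sqrt_pos.2 hk
    have h2 : 0 < Real.sqrt n := Real.sqrt_pos.2 (by linarith)
    rw [h, Real.sqrt_div (by positivity), Real.sqrt_mul (by norm_num), hc]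
    field_simp
  have hmeas : AEMeasurable (fun ω ↦ gaussianReal 0 1 (Set.Iic (c * Y ω))) P :=
    (hmono.measurable.comp (hY.const_mul c)).aemeasurable
  rw [integral_toReal hmeas (.of_forall fun _ ↦ measure_lt_top _ _),
    ← lintegral_map (f := fun x ↦ gaussianReal 0 1 (Set.Iic x)) hmono.measurable
      (hY.const_mul c), hcY, lintegral_gaussianReal_Iic, hvar, hmean]
end
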